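/- Let F be a polarized rigid graphing function (analytic near 0 ∈ ℂ⁴, holomorphic in each of the variables (z, ζ, u, v), satisfying the reality condition) with F_{zu} nonvanishing near 0 and with identically vanishing Levi determinant F_{zu}F_{ζv} − F_{ζu}F_{zv} ≡ 0 near 0. Define k := −F_{ζu}/F_{zu}, P := F_{zzu}/F_{zu}, P̄ := F_{zuu}/F_{zu}, and for analytic functions χ near 0 define the operators L₁χ := ∂_zχ, L̄₁χ := ∂_uχ, and Kχ := k·∂_zχ + ∂_ζχ. Then, identically near 0: (1) K(P̄) = −P·L̄₁(k) − L̄₁(L₁(k)); and (2) K(L̄₁(P̄)) = −L̄₁(k)·(L̄₁(P) + L₁(P̄)) − P·L̄₁(L̄₁(k)) − L̄₁(L̄₁(L₁(k))). -/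

import Mathlib

open Complex Filter Topology ComplexConjugate

/-- Partial derivative in the first (`z`) slot. -/
noncomputable def pdz (F : ℂ → ℂ → ℂ → ℂ → ℂ) : ℂ → ℂ → ℂ → ℂ → ℂ :=
  fun z ζ u v => deriv (fun t => F t ζ u v) z

/-- Partial derivative in the second (`ζ`) slot. -/
noncomputable def pdc (F : ℂ → ℂ → ℂ → ℂ → ℂ) : ℂ → ℂ → ℂ → ℂ → ℂ :=
  fun z ζ u v => deriv (fun t => F z t u v) ζ

/-- Partial derivative in the third (`u`, i.e. `z̄`) slot. -/
noncomputable def pdu (F : ℂ → ℂ → ℂ → ℂ → ℂ) : ℂ → ℂ → ℂ → ℂ → ℂ :=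
  fun z ζ u v => deriv (fun t => F z ζ t v) u

/-- Partial derivative in the fourth (`v`, i.e. `ζ̄`) slot. -/
noncomputable def pdv (F : ℂ → ℂ → ℂ → ℂ → ℂ) : ℂ → ℂ → ℂ → ℂ → ℂ :=
  fun z ζ u v => deriv (fun t => F z ζ u t) v

/-- Polarized rigid graphing function on `ℂ⁴`: analytic near the origin (hence holomorphic
in each of the four variables) and satisfying the reality condition near the origin. -/
def IsPolarized4 (F : ℂ → ℂ → ℂ → ℂ → ℂ) : Prop :=
  AnalyticAt ℂ (fun p : ℂ × ℂ × ℂ × ℂ => F p.1 p.2.1 p.2.2.1 p.2.2.2) 0 ∧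
    ∀ᶠ p : ℂ × ℂ × ℂ × ℂ in 𝓝 0,
      F p.1 p.2.1 p.2.2.1 p.2.2.2 =
        conj (F (conj p.2.2.1) (conj p.2.2.2) (conj p.1) (conj p.2.1))

/-- The Levi determinant `F_{zu}F_{ζv} − F_{ζu}F_{zv}`. -/
noncomputable def Levi (F : ℂ → ℂ → ℂ → ℂ → ℂ) : ℂ → ℂ → ℂ → ℂ → ℂ :=
  fun z ζ u v =>
    pdz (pdu F) z ζ u v * pdc (pdv F) z ζ u v -
      pdc (pdu F) z ζ u v * pdz (pdv F) z ζ u v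

/-- Taylor coefficient of `z^a ζ^b u^c v^d` in the expansion of `F` at the origin. -/
noncomputable def coeff4 (F : ℂ → ℂ → ℂ → ℂ → ℂ) (a b c d : ℕ) : ℂ :=
  (pdz^[a] (pdc^[b] (pdu^[c] (pdv^[d] F)))) 0 0 0 0 /
    ((a.factorial : ℂ) * (b.factorial : ℂ) * (c.factorial : ℂ) * (d.factorial : ℂ))

/-- Partial derivative in the first slot of a function of two variables. -/
noncomputable def p1 (f : ℂ → ℂ → ℂ) : ℂ → ℂ → ℂ := fun z ζ => deriv (fun t => f t ζ) z

/-- Partial derivative in the second slot of a function of two variables. -/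
noncomputable def p2 (f : ℂ → ℂ → ℂ) : ℂ → ℂ → ℂ := fun z ζ => deriv (fun t => f z t) ζ

/-- Jacobian determinant `f_z g_ζ − f_ζ g_z`. -/
noncomputable def Jac (f g : ℂ → ℂ → ℂ) : ℂ → ℂ → ℂ :=
  fun z ζ => p1 f z ζ * p2 g z ζ - p2 f z ζ * p1 g z ζ

/-- Conjugate function `f̄(u,v) := conj (f (conj u) (conj v))`. -/
noncomputable def bar2 (f : ℂ → ℂ → ℂ) : ℂ → ℂ → ℂ := fun u v => conj (f (conj u) (conj v))

/-- The polarized Gaussier–Merker model. -/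
noncomputable def gm : ℂ → ℂ → ℂ → ℂ → ℂ :=
  fun z ζ u v => (z * u + z ^ 2 * v / 2 + u ^ 2 * ζ / 2) / (1 - ζ * v)

/-- The slant function `k := −F_{ζu}/F_{zu}`. -/
noncomputable def slant (F : ℂ → ℂ → ℂ → ℂ → ℂ) : ℂ → ℂ → ℂ → ℂ → ℂ :=
  fun z ζ u v => -(pdc (pdu F) z ζ u v) / pdz (pdu F) z ζ u v

/-- The second fundamental function `P := F_{zzu}/F_{zu}`. -/
noncomputable def Pfun (F : ℂ → ℂ → ℂ → ℂ → ℂ) : ℂ → ℂ → ℂ → ℂ → ℂ :=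
  fun z ζ u v => pdz (pdz (pdu F)) z ζ u v / pdz (pdu F) z ζ u v

/-- The conjugate second fundamental function `P̄ := F_{zuu}/F_{zu}`. -/
noncomputable def Pbfun (F : ℂ → ℂ → ℂ → ℂ → ℂ) : ℂ → ℂ → ℂ → ℂ → ℂ :=
  fun z ζ u v => pdz (pdu (pdu F)) z ζ u v / pdz (pdu F) z ζ u v

/-- The Levi kernel derivation `Kχ := k·∂_zχ + ∂_ζχ`. -/
noncomputable def Kop (F χ : ℂ → ℂ → ℂ → ℂ → ℂ) : ℂ → ℂ → ℂ → ℂ → ℂ :=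
  fun z ζ u v => slant F z ζ u v * pdz χ z ζ u v + pdc χ z ζ u v

section DirectionalDerivative

variable {E : Type*} [NormedAddCommGroup E] [NormedSpace ℂ E]

/-- The derivative of `f` in the direction `e`. -/
noncomputable def dirDeriv (e : E) (f : E → ℂ) : E → ℂ := fun x => fderiv ℂ f x e

theorem AnalyticAt.dirDeriv {f : E → ℂ} {x : E} (hf : AnalyticAt ℂ f x) (e : E) :
    AnalyticAt ℂ (dirDeriv e f) x :=
  (ContinuousLinearMap.analyticAt (ContinuousLinearMap.apply ℂ ℂ e) _).comp hf.fderiv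

theorem Filter.EventuallyEq.dirDeriv {f g : E → ℂ} {x : E} (h : f =ᶠ[𝓝 x] g) (e : E) :
    dirDeriv e f =ᶠ[𝓝 x] dirDeriv e g :=
  (Filter.EventuallyEq.fderiv (𝕜 := ℂ) h).mono fun y hy => by simp only [_root_.dirDeriv, hy]

theorem dirDeriv_mul {f g : E → ℂ} {x : E} (hf : AnalyticAt ℂ f x) (hg : AnalyticAt ℂ g x)
    (e : E) : dirDeriv e (f * g) x = dirDeriv e f x * g x + f x * dirDeriv e g x := by
  simp only [dirDeriv, fderiv_mul hf.differentiableAt hg.differentiableAt,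
    add_apply, smul_apply, smul_eq_mul]
  ring

theorem dirDeriv_add {f g : E → ℂ} {x : E} (hf : AnalyticAt ℂ f x) (hg : AnalyticAt ℂ g x)
    (e : E) : dirDeriv e (f + g) x = dirDeriv e f x + dirDeriv e g x := by
  simp only [dirDeriv, fderiv_add hf.differentiableAt hg.differentiableAt,
    add_apply]

theorem dirDeriv_neg (f : E → ℂ) (x e : E) : dirDeriv e (-f) x = -dirDeriv e f x := by
  simp only [dirDeriv, fderiv_neg, neg_apply]

theorem dirDeriv_comm {f : E → ℂ} {x : E} (hf : AnalyticAt ℂ f x) (d e : E) :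
    dirDeriv d (dirDeriv e f) x = dirDeriv e (dirDeriv d f) x := by
  have key (d e : E) : dirDeriv d (dirDeriv e f) x = fderiv ℂ (fderiv ℂ f) x d e := by
    unfold dirDeriv
    rw [fderiv_clm_apply hf.fderiv.differentiableAt (differentiableAt_const e)]
    simp
  rw [key, key]
  exact (hf.contDiffAt (n := minSmoothness ℂ 2)).isSymmSndFDerivAt le_rfl d e

theorem dirDeriv_comm_eventuallyEq {f : E → ℂ} {x : E} (hf : AnalyticAt ℂ f x) (d e : E) :
    dirDeriv d (dirDeriv e f) =ᶠ[𝓝 x] dirDeriv e (dirDeriv d f) :=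
  hf.eventually_analyticAt.mono fun _ hy => dirDeriv_comm hy d e

/-- If `k = -b / a` with `∂₁ b = ∂₂ a`, then `K = k ∂₁ + ∂₂` satisfies
`K (∂₃ a / a) = -(∂₁ a / a) ∂₃ k - ∂₃ ∂₁ k`. -/
theorem kernel_logDeriv {a b : E → ℂ} {x : E} (ha : AnalyticAt ℂ a x) (hb : AnalyticAt ℂ b x)
    (h0 : a x ≠ 0) (d e f : E) (hab : dirDeriv d b =ᶠ[𝓝 x] dirDeriv e a) :
    (-b / a) x * dirDeriv d (dirDeriv f a / a) x + dirDeriv e (dirDeriv f a / a) x =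
      -(dirDeriv d a / a) x * dirDeriv f (-b / a) x - dirDeriv f (dirDeriv d (-b / a)) x := by
  have hk : AnalyticAt ℂ (-b / a) x := hb.neg.div ha h0
  have hP : AnalyticAt ℂ (dirDeriv d a / a) x := (ha.dirDeriv d).div ha h0
  have hQ : AnalyticAt ℂ (dirDeriv f a / a) x := (ha.dirDeriv f).div ha h0
  have hne : ∀ᶠ y in 𝓝 x, a y ≠ 0 := ha.continuousAt.eventually_ne h0
  have haP : dirDeriv d a =ᶠ[𝓝 x] dirDeriv d a / a * a :=
    hne.mono fun y hy => by simp [hy]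
  have haQ : dirDeriv f a =ᶠ[𝓝 x] dirDeriv f a / a * a :=
    hne.mono fun y hy => by simp [hy]
  have hbk : b =ᶠ[𝓝 x] -(-b / a * a) :=
    hne.mono fun y hy => by simp [hy]
  have hae : dirDeriv e a =ᶠ[𝓝 x]
      -((dirDeriv d (-b / a) + -b / a * (dirDeriv d a / a)) * a) := by
    filter_upwards [hab, hbk.dirDeriv d, hk.eventually_analyticAt, ha.eventually_analyticAt,
      haP] with y h1 h2 h3 h4 h5
    rw [← h1, h2, dirDeriv_neg, dirDeriv_mul h3 h4, h5]
    simp only [Pi.neg_apply, Pi.add_apply, Pi.mul_apply]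
    ring
  generalize -b / a = k at *
  generalize dirDeriv d a / a = P at *
  generalize dirDeriv f a / a = Q at *
  have hdf := dirDeriv_comm ha d f
  rw [(haP.dirDeriv f).eq_of_nhds, (haQ.dirDeriv d).eq_of_nhds, dirDeriv_mul hP ha,
    dirDeriv_mul hQ ha, haP.eq_of_nhds, haQ.eq_of_nhds] at hdf
  have hef := dirDeriv_comm ha e f
  rw [(hae.dirDeriv f).eq_of_nhds, (haQ.dirDeriv e).eq_of_nhds, dirDeriv_neg,
    dirDeriv_mul ((hk.dirDeriv d).add (hk.mul hP)) ha, dirDeriv_add (hk.dirDeriv d) (hk.mul hP),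
    dirDeriv_mul hk hP, dirDeriv_mul hQ ha, hae.eq_of_nhds, haQ.eq_of_nhds] at hef
  simp only [Pi.neg_apply, Pi.add_apply, Pi.mul_apply] at hdf hef
  apply mul_right_cancel₀ h0
  linear_combination k x * hdf + hef

/-- The derivative of `kernel_logDeriv` in the direction `f`. -/
theorem kernel_dirDeriv_logDeriv {a b : E → ℂ} {x : E} (ha : AnalyticAt ℂ a x)
    (hb : AnalyticAt ℂ b x) (h0 : a x ≠ 0) (d e f : E)
    (hab : dirDeriv d b =ᶠ[𝓝 x] dirDeriv e a) :
    (-b / a) x * dirDeriv d (dirDeriv f (dirDeriv f a / a)) x +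
        dirDeriv e (dirDeriv f (dirDeriv f a / a)) x =
      -dirDeriv f (-b / a) x *
          (dirDeriv f (dirDeriv d a / a) x + dirDeriv d (dirDeriv f a / a) x) -
        (dirDeriv d a / a) x * dirDeriv f (dirDeriv f (-b / a)) x -
        dirDeriv f (dirDeriv f (dirDeriv d (-b / a))) x := by
  have hk : AnalyticAt ℂ (-b / a) x := hb.neg.div ha h0
  have hP : AnalyticAt ℂ (dirDeriv d a / a) x := (ha.dirDeriv d).div ha h0
  have hQ : AnalyticAt ℂ (dirDeriv f a / a) x := (ha.dirDeriv f).div ha h0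
  have h : -b / a * dirDeriv d (dirDeriv f a / a) + dirDeriv e (dirDeriv f a / a) =ᶠ[𝓝 x]
      -(dirDeriv d a / a * dirDeriv f (-b / a) + dirDeriv f (dirDeriv d (-b / a))) := by
    filter_upwards [ha.eventually_analyticAt, hb.eventually_analyticAt,
      ha.continuousAt.eventually_ne h0, hab.eventuallyEq_nhds] with y h1 h2 h3 h4
    have := kernel_logDeriv h1 h2 h3 d e f h4
    simp only [Pi.neg_apply, Pi.add_apply, Pi.mul_apply]
    linear_combination this
  generalize -b / a = k at *
  generalize dirDeriv d a / a = P at *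
  generalize dirDeriv f a / a = Q at *
  have h' := (h.dirDeriv f).eq_of_nhds
  rw [dirDeriv_neg, dirDeriv_add (hk.mul (hQ.dirDeriv d)) (hQ.dirDeriv e),
    dirDeriv_mul hk (hQ.dirDeriv d),
    dirDeriv_add (hP.mul (hk.dirDeriv f)) ((hk.dirDeriv d).dirDeriv f),
    dirDeriv_mul hP (hk.dirDeriv f), dirDeriv_comm hQ f d, dirDeriv_comm hQ f e] at h'
  linear_combination h'

end DirectionalDerivative

/-- The function on `ℂ⁴` associated with a function of four complex variables. -/
def uncurry4 (χ : ℂ → ℂ → ℂ → ℂ → ℂ) : ℂ × ℂ × ℂ × ℂ → ℂ :=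
  fun p => χ p.1 p.2.1 p.2.2.1 p.2.2.2

theorem deriv_eq_dirDeriv {f : ℂ × ℂ × ℂ × ℂ → ℂ} {c : ℂ → ℂ × ℂ × ℂ × ℂ} {t : ℂ}
    {e : ℂ × ℂ × ℂ × ℂ} (hf : DifferentiableAt ℂ f (c t)) (hc : HasDerivAt c e t) :
    deriv (fun s => f (c s)) t = dirDeriv e f (c t) :=
  (hf.hasFDerivAt.comp_hasDerivAt t hc).deriv

section PartialDerivative

variable {χ : ℂ → ℂ → ℂ → ℂ → ℂ} {f : ℂ × ℂ × ℂ × ℂ → ℂ}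

theorem uncurry4_pdz_eventuallyEq (h : uncurry4 χ =ᶠ[𝓝 0] f) (hf : AnalyticAt ℂ f 0) :
    uncurry4 (pdz χ) =ᶠ[𝓝 0] dirDeriv (1, 0, 0, 0) f := by
  refine EventuallyEq.trans ?_ (h.dirDeriv _)
  filter_upwards [(hf.congr h.symm).eventually_analyticAt] with p hp
  exact deriv_eq_dirDeriv (c := fun t => (t, p.2.1, p.2.2.1, p.2.2.2)) hp.differentiableAt
    ((hasDerivAt_id _).prodMk (hasDerivAt_const _ _))

theorem uncurry4_pdc_eventuallyEq (h : uncurry4 χ =ᶠ[𝓝 0] f) (hf : AnalyticAt ℂ f 0) :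
    uncurry4 (pdc χ) =ᶠ[𝓝 0] dirDeriv (0, 1, 0, 0) f := by
  refine EventuallyEq.trans ?_ (h.dirDeriv _)
  filter_upwards [(hf.congr h.symm).eventually_analyticAt] with p hp
  exact deriv_eq_dirDeriv (c := fun t => (p.1, t, p.2.2.1, p.2.2.2)) hp.differentiableAt
    ((hasDerivAt_const _ _).prodMk ((hasDerivAt_id _).prodMk (hasDerivAt_const _ _)))

theorem uncurry4_pdu_eventuallyEq (h : uncurry4 χ =ᶠ[𝓝 0] f) (hf : AnalyticAt ℂ f 0) :
    uncurry4 (pdu χ) =ᶠ[𝓝 0] dirDeriv (0, 0, 1, 0) f := by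
  refine EventuallyEq.trans ?_ (h.dirDeriv _)
  filter_upwards [(hf.congr h.symm).eventually_analyticAt] with p hp
  exact deriv_eq_dirDeriv (c := fun t => (p.1, p.2.1, t, p.2.2.2)) hp.differentiableAt
    ((hasDerivAt_const _ _).prodMk
      ((hasDerivAt_const _ _).prodMk ((hasDerivAt_id _).prodMk (hasDerivAt_const _ _))))

end PartialDerivative

/-- the two identities `K(P̄) = −P·L̄₁(k) − L̄₁(L₁(k))` and
`K(L̄₁(P̄)) = −L̄₁(k)·(L̄₁(P) + L₁(P̄)) − P·L̄₁(L̄₁(k)) − L̄₁(L̄₁(L₁(k)))`, where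
`L₁ = ∂_z` and `L̄₁ = ∂_u`. -/
theorem stmt17
    (F : ℂ → ℂ → ℂ → ℂ → ℂ) (hF : IsPolarized4 F)
    (hzu : ∀ᶠ p : ℂ × ℂ × ℂ × ℂ in 𝓝 0,
      pdz (pdu F) p.1 p.2.1 p.2.2.1 p.2.2.2 ≠ 0)
    (hLevi : ∀ᶠ p : ℂ × ℂ × ℂ × ℂ in 𝓝 0, Levi F p.1 p.2.1 p.2.2.1 p.2.2.2 = 0) :
    ∀ᶠ p : ℂ × ℂ × ℂ × ℂ in 𝓝 0,
      (Kop F (Pbfun F) p.1 p.2.1 p.2.2.1 p.2.2.2 =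
          -(Pfun F p.1 p.2.1 p.2.2.1 p.2.2.2) *
              pdu (slant F) p.1 p.2.1 p.2.2.1 p.2.2.2 -
            pdu (pdz (slant F)) p.1 p.2.1 p.2.2.1 p.2.2.2) ∧
      (Kop F (pdu (Pbfun F)) p.1 p.2.1 p.2.2.1 p.2.2.2 =
          -(pdu (slant F) p.1 p.2.1 p.2.2.1 p.2.2.2) *
              (pdu (Pfun F) p.1 p.2.1 p.2.2.1 p.2.2.2 +
                pdz (Pbfun F) p.1 p.2.1 p.2.2.1 p.2.2.2) -
            Pfun F p.1 p.2.1 p.2.2.1 p.2.2.2 *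
              pdu (pdu (slant F)) p.1 p.2.1 p.2.2.1 p.2.2.2 -
            pdu (pdu (pdz (slant F))) p.1 p.2.1 p.2.2.1 p.2.2.2) := by
  have hF0 : AnalyticAt ℂ (uncurry4 F) 0 := hF.1
  have hG := hF0.dirDeriv (0, 0, 1, 0)
  have eG := uncurry4_pdu_eventuallyEq (EventuallyEq.refl _ (uncurry4 F)) hF0
  generalize dirDeriv (0, 0, 1, 0) (uncurry4 F) = G at hG eG
  have ea := uncurry4_pdz_eventuallyEq eG hG
  have eb := uncurry4_pdc_eventuallyEq eG hG
  have eGu := uncurry4_pdu_eventuallyEq eG hG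
  have ha := hG.dirDeriv (1, 0, 0, 0)
  have hb := hG.dirDeriv (0, 1, 0, 0)
  have eaz := uncurry4_pdz_eventuallyEq ea ha
  have eau := (uncurry4_pdz_eventuallyEq eGu (hG.dirDeriv _)).trans
    (dirDeriv_comm_eventuallyEq hG _ _)
  have hab := dirDeriv_comm_eventuallyEq hG (1, 0, 0, 0) (0, 1, 0, 0)
  generalize dirDeriv (1, 0, 0, 0) G = a at *
  generalize dirDeriv (0, 1, 0, 0) G = b at *
  have h0 : a 0 ≠ 0 := by
    rw [← ea.eq_of_nhds]
    exact hzu.self_of_nhds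
  have hk : AnalyticAt ℂ (-b / a) 0 := hb.neg.div ha h0
  have hP : AnalyticAt ℂ (dirDeriv (1, 0, 0, 0) a / a) 0 := (ha.dirDeriv _).div ha h0
  have hQ : AnalyticAt ℂ (dirDeriv (0, 0, 1, 0) a / a) 0 := (ha.dirDeriv _).div ha h0
  have ek : uncurry4 (slant F) =ᶠ[𝓝 0] -b / a := eb.neg.div ea
  have eP : uncurry4 (Pfun F) =ᶠ[𝓝 0] dirDeriv (1, 0, 0, 0) a / a := eaz.div ea
  have eQ : uncurry4 (Pbfun F) =ᶠ[𝓝 0] dirDeriv (0, 0, 1, 0) a / a := eau.div ea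
  have ekz := uncurry4_pdz_eventuallyEq ek hk
  have eku := uncurry4_pdu_eventuallyEq ek hk
  have ekzu := uncurry4_pdu_eventuallyEq ekz (hk.dirDeriv _)
  have eQu := uncurry4_pdu_eventuallyEq eQ hQ
  filter_upwards [ha.eventually_analyticAt, hb.eventually_analyticAt,
    ha.continuousAt.eventually_ne h0, hab.eventuallyEq_nhds, ek, eP, eku, ekzu, eQu,
    uncurry4_pdz_eventuallyEq eQ hQ, uncurry4_pdc_eventuallyEq eQ hQ,
    uncurry4_pdz_eventuallyEq eQu (hQ.dirDeriv _), uncurry4_pdc_eventuallyEq eQu (hQ.dirDeriv _),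
    uncurry4_pdu_eventuallyEq eP hP, uncurry4_pdu_eventuallyEq eku (hk.dirDeriv _),
    uncurry4_pdu_eventuallyEq ekzu ((hk.dirDeriv _).dirDeriv _)]
    with p pa pb p0 pab pk pP pku pkzu pQu pQz pQc pQuz pQuc pPu pkuu pkzuu
  have h1 := kernel_logDeriv pa pb p0 _ _ (0, 0, 1, 0) pab
  have h2 := kernel_dirDeriv_logDeriv pa pb p0 _ _ (0, 0, 1, 0) pab
  rw [← pk, ← pP, ← pku, ← pkzu, ← pQz, ← pQc] at h1
  rw [← pk, ← pP, ← pku, ← pQz, ← pQuz, ← pQuc, ← pPu, ← pkuu, ← pkzuu] at h2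
  exact ⟨h1, h2⟩
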